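/- Let p ≥ 1 be an integer and let l1, l2 be positive reals. Set f(b) = -l1·b^(2p+4) + (l2 + l1)·b^(2p+3) - ((p+1)²·l2 - (2p+3)·l1)·b^(p+3) + 2·(p(p+2)·l2 - (2p+3)·l1)·b^(p+2) - ((p+1)²·l2 - (2p+3)·l1)·b^(p+1) + (l2 + l1)·b - l1. If l2 ≤ (2·(2p+3)/(p·(p+1)))·l1, then b = 1 is the only positive real root of f. -/

import Mathlib

lemma coefE (q : ℝ) (hq : 1 ≤ q) (k : ℕ) :
    q*(q+1)*(-((q+2)^2)^(k+1) + ((q+1)^2)^(k+1) + (2*q+3))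
      + 2*(2*q+3)*(((q+1)^2)^(k+1) - (q+1)^2) ≤ 0 := by
  induction k with
  | zero => apply le_of_eq; ring
  | succ k ih =>
    have hv : (q+2)^2 ≤ ((q+2)^2)^(k+1) :=
      le_self_pow₀ (by nlinarith) (by omega)
    have h1 : 0 ≤ (2*q+3)*(q*(q+1)) := by positivity
    have h2 := mul_le_mul_of_nonneg_left hv h1
    have h3 := mul_le_mul_of_nonneg_left ih (sq_nonneg (q+1))
    rw [pow_succ ((q+2)^2) (k+1), pow_succ ((q+1)^2) (k+1)]
    generalize ((q+2)^2)^(k+1) = V at *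
    generalize ((q+1)^2)^(k+1) = U at *
    linarith

lemma coefU (q : ℝ) (hq : 1 ≤ q) (k : ℕ) : 0 ≤ ((q+1)^2)^(k+1) - (q+1)^2 :=
  sub_nonneg.2 (le_self_pow₀ (by nlinarith) (by omega))

/-- Coefficients of the hyperbolic cosine expansion. -/
noncomputable def cf (q l1 l2 : ℝ) (k : ℕ) : ℝ :=
  l1*(-(q+2)^(2*k) + (q+1)^(2*k) + (2*q+3)*(1^(2*k) - 0^(2*k)))
    + l2*((q+1)^(2*k) - (q+1)^2*1^(2*k) + q*(q+2)*0^(2*k))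

lemma cf_key (q l1 l2 : ℝ) (hq : 1 ≤ q) (hle : l2*(q*(q+1)) ≤ 2*(2*q+3)*l1) (k : ℕ) :
    (q*(q+1)) * cf q l1 l2 (k+1) ≤ l1*(q*(q+1)*(-((q+2)^2)^(k+1) + ((q+1)^2)^(k+1) + (2*q+3))
      + 2*(2*q+3)*(((q+1)^2)^(k+1) - (q+1)^2)) := by
  have h := mul_le_mul_of_nonneg_right hle (coefU q hq k)
  have h0 : (0:ℝ)^(2*(k+1)) = 0 := by simp
  simp only [cf, h0, one_pow]
  rw [pow_mul, pow_mul]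
  linarith

lemma cf_nonpos (q l1 l2 : ℝ) (hq : 1 ≤ q) (hl1 : 0 < l1)
    (hle : l2*(q*(q+1)) ≤ 2*(2*q+3)*l1) (k : ℕ) : cf q l1 l2 k ≤ 0 := by
  cases k with
  | zero => apply le_of_eq; simp [cf]; right; ring
  | succ k =>
    have h := cf_key q l1 l2 hq hle k
    have h2 := mul_nonpos_of_nonneg_of_nonpos hl1.le (coefE q hq k)
    have h3 : 0 < q*(q+1) := by positivity
    by_contra hc
    have := mul_pos h3 (not_le.1 hc)
    linarith

lemma cf_three (q l1 l2 : ℝ) (hq : 1 ≤ q) (hl1 : 0 < l1)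
    (hle : l2*(q*(q+1)) ≤ 2*(2*q+3)*l1) : cf q l1 l2 3 < 0 := by
  have h := cf_key q l1 l2 hq hle 2
  have h3 : 0 < q*(q+1) := by positivity
  have h4 : 0 < l1*((2*q+3)*(q*(q+1))*(q+2)^2*((q+1)*(q+3))) := by positivity
  by_contra hc
  have := mul_nonneg h3.le (not_lt.1 hc)
  norm_num at h this
  linarith

lemma cosh_neg_sum (q l1 l2 s : ℝ) (hq : 1 ≤ q) (hl1 : 0 < l1) (hs : s ≠ 0)
    (hle : l2*(q*(q+1)) ≤ 2*(2*q+3)*l1) :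
    l1*(-Real.cosh ((q+2)*s) + Real.cosh ((q+1)*s) + (2*q+3)*(Real.cosh (1*s) - Real.cosh (0*s)))
    + l2*(Real.cosh ((q+1)*s) - (q+1)^2*Real.cosh (1*s) + q*(q+2)*Real.cosh (0*s)) < 0 := by
  have H (a : ℝ) := Real.hasSum_cosh (a*s)
  have h := ((((H (q+2)).neg.add (H (q+1))).add
      (((H 1).sub (H 0)).mul_left (2*q+3))).mul_left l1).add
    ((((H (q+1)).sub ((H 1).mul_left ((q+1)^2))).add ((H 0).mul_left (q*(q+2)))).mul_left l2)
  have hfun := funext (f := fun k : ℕ => cf q l1 l2 k * (s^(2*k) / ((2*k).factorial : ℝ)))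
    (g := _) (fun k => show _ = l1 *
          (-(((q + 2) * s) ^ (2 * k) / ((2 * k).factorial : ℝ)) + ((q + 1) * s) ^ (2 * k) / ((2 * k).factorial : ℝ) +
            (2 * q + 3) * ((1 * s) ^ (2 * k) / ((2 * k).factorial : ℝ) - (0 * s) ^ (2 * k) / ((2 * k).factorial : ℝ))) +
        l2 *
          (((q + 1) * s) ^ (2 * k) / ((2 * k).factorial : ℝ) - (q + 1) ^ 2 * ((1 * s) ^ (2 * k) / ((2 * k).factorial : ℝ)) +
            q * (q + 2) * ((0 * s) ^ (2 * k) / ((2 * k).factorial : ℝ))) by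
      simp only [cf, mul_pow]
      ring)
  have h' := h
  rw [← hfun] at h'
  have hw (k : ℕ) : 0 < s^(2*k) / ((2*k).factorial : ℝ) := by
    have : 0 < s^(2*k) := by rw [pow_mul]; positivity
    positivity
  refine hasSum_lt (i := 3) (fun k => ?_) ?_ h' hasSum_zero
  · exact mul_nonpos_of_nonpos_of_nonneg (cf_nonpos q l1 l2 hq hl1 hle k) (hw k).le
  · exact mul_neg_of_neg_of_pos (cf_three q l1 l2 hq hl1 hle) (hw 3)

lemma cosh_nat (b : ℝ) (hb : 0 < b) (n : ℕ) :
    Real.cosh ((n:ℝ) * Real.log b) = (b^n + (b^n)⁻¹)/2 := by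
  rw [Real.cosh_eq, Real.exp_neg, Real.exp_nat_mul, Real.exp_log hb]

/-- If `l₂ ≤ (2(2p+3)/(p(p+1)))·l₁` then `b = 1` is the only positive real root of the
CSC condition polynomial `f` for the Wang–Ziller manifold `M^{1,p}_{l₂,l₁}`. -/
theorem stmt8 (p : ℕ) (hp : 1 ≤ p) (l1 l2 : ℝ) (hl1 : 0 < l1) (hl2 : 0 < l2)
    (hle : l2 ≤ (2 * (2 * (p : ℝ) + 3) / ((p : ℝ) * ((p : ℝ) + 1))) * l1)
    (f : ℝ → ℝ)
    (hf : ∀ b : ℝ, f b =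
      -l1 * b ^ (2 * p + 4) + (l2 + l1) * b ^ (2 * p + 3)
      - (((p : ℝ) + 1) ^ 2 * l2 - (2 * (p : ℝ) + 3) * l1) * b ^ (p + 3)
      + 2 * ((p : ℝ) * ((p : ℝ) + 2) * l2 - (2 * (p : ℝ) + 3) * l1) * b ^ (p + 2)
      - (((p : ℝ) + 1) ^ 2 * l2 - (2 * (p : ℝ) + 3) * l1) * b ^ (p + 1)
      + (l2 + l1) * b - l1) :
    ∀ b : ℝ, 0 < b → f b = 0 → b = 1 := by
  intro b hb h0
  by_contra hb1
  have hq : (1:ℝ) ≤ p := by exact_mod_cast hp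
  have hle' : l2*((p:ℝ)*(p+1)) ≤ 2*(2*(p:ℝ)+3)*l1 := by
    have h3 : 0 < (p:ℝ)*(p+1) := by positivity
    rw [div_mul_eq_mul_div, le_div_iff₀ h3] at hle
    exact hle
  have hs : Real.log b ≠ 0 := Real.log_ne_zero_of_pos_of_ne_one hb hb1
  have key := cosh_neg_sum p l1 l2 (Real.log b) hq hl1 hs hle'
  have e2 := cosh_nat b hb (p+2)
  have e1 := cosh_nat b hb (p+1)
  have e0 := cosh_nat b hb 1
  push_cast at e2 e1 e0
  rw [e2, e1, e0, zero_mul, Real.cosh_zero] at key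
  have hX : 0 < 2 * b^(p+2) := by positivity
  have := mul_neg_of_pos_of_neg hX key
  refine absurd h0 (ne_of_lt (lt_of_eq_of_lt ?_ this))
  rw [hf]
  have hbp : b^p ≠ 0 := by positivity
  have hb0 := hb.ne'
  have x1 : b^(2*p+4) = (b^p)^2*b^4 := by ring
  have x2 : b^(2*p+3) = (b^p)^2*b^3 := by ring
  simp only [x1, x2, pow_add b p]
  generalize b^p = X at *
  field_simp
  ring
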